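/- Let d ≥ 2 and let T be the d-regular tree. Let M : ℓ²(T) → ℓ²(T) be the Markov operator of the simple random walk on the vertices of T, defined by Mf(v) = (1/d) Σ_{w∼v} f(w), where the sum is over the d neighbours w of v. Then the operator norm of M equals 2√(d−1)/d. In particular, for the free group F_N on N generators a₁,…,a_N with μ the uniform distribution on {a₁^{±1},…,a_N^{±1}}, the norm of the convolution operator π_{F_N}(μ) on ℓ²(F_N) equals √(2N−1)/N. -/

import Mathlib

open MeasureTheory Filter Topology

/-- A locally finite graph, given by its neighbour sets, together with a level function having
`o` as its only vertex of level `0`, in which every vertex has `q + 1` neighbours, adjacent vertices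
lie on consecutive levels, and each vertex other than `o` has exactly one neighbour on
the previous level. -/
structure IsLeveledRegularTree {V : Type*} (nbr : V → Finset V) (level : V → ℕ) (q : ℕ) (o : V) :
    Prop where
  symm : ∀ v w, w ∈ nbr v → v ∈ nbr w
  card_nbr : ∀ v, (nbr v).card = q + 1
  level_eq_zero : ∀ v, level v = 0 ↔ v = o
  level_step : ∀ v w, w ∈ nbr v → level w = level v + 1 ∨ level v = level w + 1
  parent : ∀ v, level v ≠ 0 → ∃! w, w ∈ nbr v ∧ level v = level w + 1

lemma inv_sqrt_pow_add_mul_inv_sqrt_pow {x : ℝ} (hx : 0 < x) (k : ℕ) :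
    (√x)⁻¹ ^ k + x * (√x)⁻¹ ^ (k + 2) = 2 * √x * (√x)⁻¹ ^ (k + 1) := by
  have h1 : √x * (√x)⁻¹ = 1 := mul_inv_cancel₀ (Real.sqrt_pos.2 hx).ne'
  have h2 : √x ^ 2 = x := Real.sq_sqrt hx.le
  linear_combination (√x)⁻¹ ^ k * (√x * (√x)⁻¹ - 1) * h1 - (√x)⁻¹ ^ (k + 2) * h2

namespace IsLeveledRegularTree

variable {V : Type*} {nbr : V → Finset V} {level : V → ℕ} {q : ℕ} {o : V}

lemma sum_level_of_eq_zero {R : Type*} [Semiring R] (h : IsLeveledRegularTree nbr level q o)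
    (g : ℕ → R) {v : V} (hv : level v = 0) :
    ∑ w ∈ nbr v, g (level w) = (q + 1) * g 1 := by
  have : ∀ w ∈ nbr v, g (level w) = g 1 := by
    intro w hw
    rcases h.level_step v w hw with h1 | h1
    · rw [h1, hv]
    · omega
  rw [Finset.sum_congr rfl this, Finset.sum_const, h.card_nbr, nsmul_eq_mul]
  push_cast
  rfl

lemma sum_level_of_eq_succ {R : Type*} [Semiring R] (h : IsLeveledRegularTree nbr level q o)
    (g : ℕ → R) {v : V} {k : ℕ} (hv : level v = k + 1) :
    ∑ w ∈ nbr v, g (level w) = g k + q * g (k + 2) := by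
  classical
  obtain ⟨p, ⟨hp, hpl⟩, huniq⟩ := h.parent v (by omega)
  have hrest : ∀ w ∈ (nbr v).erase p, g (level w) = g (k + 2) := by
    intro w hw
    rw [Finset.mem_erase] at hw
    rcases h.level_step v w hw.2 with h1 | h1
    · rw [h1, hv]
    · exact absurd (huniq w ⟨hw.2, h1⟩) hw.1
  rw [← Finset.add_sum_erase _ _ hp, Finset.sum_congr rfl hrest, Finset.sum_const,
    Finset.card_erase_of_mem hp, h.card_nbr, nsmul_eq_mul, show level p = k by omega]
  simp

lemma exists_sphere (h : IsLeveledRegularTree nbr level q o) (k : ℕ) :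
    ∃ S : Finset V, (∀ v, v ∈ S ↔ level v = k + 1) ∧ S.card = (q + 1) * q ^ k := by
  classical
  induction k with
  | zero =>
    refine ⟨nbr o, fun v => ⟨fun hv => ?_, fun hv => ?_⟩, by simp [h.card_nbr]⟩
    · have h0 := (h.level_eq_zero o).2 rfl
      rcases h.level_step o v hv with h1 | h1 <;> omega
    · obtain ⟨p, ⟨hp, hpl⟩, -⟩ := h.parent v (by omega)
      obtain rfl := (h.level_eq_zero p).1 (by omega)
      exact h.symm _ _ hp
  | succ k ih =>
    obtain ⟨S, hS, hcard⟩ := ih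
    refine ⟨S.biUnion fun v => (nbr v).filter fun w => level w = k + 2, fun v => ?_, ?_⟩
    · simp only [Finset.mem_biUnion, Finset.mem_filter]
      constructor
      · rintro ⟨w, -, -, hv⟩
        exact hv
      · intro hv
        obtain ⟨p, ⟨hp, hpl⟩, -⟩ := h.parent v (by omega)
        exact ⟨p, (hS p).2 (by omega), h.symm _ _ hp, hv⟩
    · have hchildren : ∀ v ∈ S, ((nbr v).filter fun w => level w = k + 2).card = q := by
        intro v hv
        rw [Finset.card_filter]
        have := h.sum_level_of_eq_succ (fun j => if j = k + 2 then 1 else 0) ((hS v).1 hv)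
        simpa using this
      rw [Finset.card_biUnion, Finset.sum_congr rfl hchildren, Finset.sum_const, hcard,
        smul_eq_mul, pow_succ, mul_assoc]
      intro v hv w hw hvw
      rw [Function.onFun, Finset.disjoint_left]
      intro x hx hx'
      rw [Finset.mem_filter] at hx hx'
      refine hvw ((h.parent x (by omega)).unique ⟨h.symm _ _ hx.1, ?_⟩ ⟨h.symm _ _ hx'.1, ?_⟩)
      · rw [(hS v).1 hv, hx.2]
      · rw [(hS w).1 hw, hx.2]

lemma sum_weight_le (h : IsLeveledRegularTree nbr level q o) (hq : 1 ≤ q) (v : V) :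
    ∑ w ∈ nbr v, (√(q : ℝ))⁻¹ ^ level w ≤ 2 * √(q : ℝ) * (√(q : ℝ))⁻¹ ^ level v := by
  have hq' : (1 : ℝ) ≤ q := by exact_mod_cast hq
  have hs : 0 < √(q : ℝ) := Real.sqrt_pos.2 (by linarith)
  have hsq : √(q : ℝ) ^ 2 = q := Real.sq_sqrt (by linarith)
  rcases hv : level v with _ | k
  · rw [h.sum_level_of_eq_zero (fun j => (√(q : ℝ))⁻¹ ^ j) hv, pow_zero, pow_one,
      ← div_eq_mul_inv, div_le_iff₀ hs]
    nlinarith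
  · rw [h.sum_level_of_eq_succ (fun j => (√(q : ℝ))⁻¹ ^ j) hv]
    exact (inv_sqrt_pow_add_mul_inv_sqrt_pow (by linarith) k).le

variable {M : lp (fun _ : V => ℂ) 2 →L[ℂ] lp (fun _ : V => ℂ) 2}

lemma sum_norm_sq_le (f : lp (fun _ : V => ℂ) 2) (s : Finset V) :
    ∑ v ∈ s, ‖f v‖ ^ 2 ≤ ‖f‖ ^ 2 := by
  have := lp.sum_rpow_le_norm_rpow (p := 2) (by simp) f s
  simpa using this

lemma norm_le (h : IsLeveledRegularTree nbr level q o) (hq : 1 ≤ q)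
    (hM : ∀ (f : lp (fun _ : V => ℂ) 2) (v : V),
      (M f) v = (1 / ((q : ℂ) + 1)) * ∑ w ∈ nbr v, f w) :
    ‖M‖ ≤ 2 * √(q : ℝ) / (q + 1) := by
  classical
  have hs : 0 < √(q : ℝ) := Real.sqrt_pos.2 (by exact_mod_cast hq)
  set c := 2 * √(q : ℝ) with hc
  set φ : V → ℝ := fun v => (√(q : ℝ))⁻¹ ^ level v with hφ
  have hφ0 : ∀ v, 0 < φ v := fun v => by positivity
  have hsum : ∀ v, ∑ w ∈ nbr v, φ w ≤ c * φ v := h.sum_weight_le hq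
  refine M.opNorm_le_bound (by positivity) fun f => ?_
  refine lp.norm_le_of_forall_sum_le (by simp) (by positivity) fun s => ?_
  simp only [ENNReal.toReal_ofNat, Real.rpow_ofNat]
  have hpt : ∀ v, ‖(M f) v‖ ^ 2 ≤
      (1 / ((q : ℝ) + 1)) ^ 2 * c * ∑ w ∈ nbr v, φ v * (‖f w‖ ^ 2 / φ w) := by
    intro v
    have hn : ‖(1 / ((q : ℂ) + 1))‖ = 1 / ((q : ℝ) + 1) := by
      rw [norm_div, norm_one]
      norm_cast
    have hcs : (∑ w ∈ nbr v, ‖f w‖) ^ 2 ≤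
        (∑ w ∈ nbr v, φ w) * ∑ w ∈ nbr v, ‖f w‖ ^ 2 / φ w := by
      refine Finset.sum_sq_le_sum_mul_sum_of_sq_le_mul _ (fun w _ => (hφ0 w).le)
        (fun w _ => by have := hφ0 w; positivity) fun w _ => ?_
      rw [mul_div_cancel₀ _ (hφ0 w).ne']
    have h0 : 0 ≤ ∑ w ∈ nbr v, ‖f w‖ ^ 2 / φ w :=
      Finset.sum_nonneg fun w _ => by have := hφ0 w; positivity
    rw [hM, norm_mul, mul_pow, hn, mul_assoc, ← Finset.mul_sum]
    gcongr
    calc ‖∑ w ∈ nbr v, f w‖ ^ 2 ≤ (∑ w ∈ nbr v, ‖f w‖) ^ 2 := by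
          gcongr
          exact norm_sum_le _ _
      _ ≤ _ := hcs
      _ ≤ (c * φ v) * ∑ w ∈ nbr v, ‖f w‖ ^ 2 / φ w := by
          gcongr
          exact hsum v
      _ = _ := by ring
  have hdouble : ∑ v ∈ s, ∑ w ∈ nbr v, φ v * (‖f w‖ ^ 2 / φ w) ≤ c * ‖f‖ ^ 2 := by
    calc ∑ v ∈ s, ∑ w ∈ nbr v, φ v * (‖f w‖ ^ 2 / φ w)
        = ∑ w ∈ s.biUnion nbr, ∑ v ∈ (nbr w).filter (· ∈ s), φ v * (‖f w‖ ^ 2 / φ w) := by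
          refine Finset.sum_comm' fun v w => ?_
          simp only [Finset.mem_filter, Finset.mem_biUnion]
          constructor
          · rintro ⟨hv, hw⟩
            exact ⟨⟨h.symm _ _ hw, hv⟩, v, hv, hw⟩
          · rintro ⟨⟨hv, hs⟩, -⟩
            exact ⟨hs, h.symm _ _ hv⟩
      _ ≤ ∑ w ∈ s.biUnion nbr, c * ‖f w‖ ^ 2 := by
          refine Finset.sum_le_sum fun w _ => ?_
          have hw := hφ0 w
          calc _ ≤ ∑ v ∈ nbr w, φ v * (‖f w‖ ^ 2 / φ w) :=
                Finset.sum_le_sum_of_subset_of_nonneg (Finset.filter_subset _ _)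
                  fun v _ _ => by have := hφ0 v; positivity
            _ ≤ c * φ w * (‖f w‖ ^ 2 / φ w) := by
                rw [← Finset.sum_mul]
                gcongr
                exact hsum w
            _ = c * ‖f w‖ ^ 2 := by field_simp
      _ ≤ c * ‖f‖ ^ 2 := by
          rw [← Finset.mul_sum]
          gcongr
          exact sum_norm_sq_le f _
  calc ∑ v ∈ s, ‖(M f) v‖ ^ 2
      ≤ (1 / ((q : ℝ) + 1)) ^ 2 * c * ∑ v ∈ s, ∑ w ∈ nbr v, φ v * (‖f w‖ ^ 2 / φ w) := by
        rw [Finset.mul_sum]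
        exact Finset.sum_le_sum fun v _ => hpt v
    _ ≤ (1 / ((q : ℝ) + 1)) ^ 2 * c * (c * ‖f‖ ^ 2) := by gcongr
    _ = (c / (q + 1) * ‖f‖) ^ 2 := by ring

lemma mul_le_norm_sq_mul (h : IsLeveledRegularTree nbr level q o) (hq : 1 ≤ q)
    (hM : ∀ (f : lp (fun _ : V => ℂ) 2) (v : V),
      (M f) v = (1 / ((q : ℂ) + 1)) * ∑ w ∈ nbr v, f w) (n : ℕ) :
    n * (2 * √(q : ℝ) / (q + 1)) ^ 2 ≤ ‖M‖ ^ 2 * (n + 2) := by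
  classical
  have hq0 : (0 : ℝ) < q := by exact_mod_cast hq
  have hsq : √(q : ℝ) ^ 2 = q := Real.sq_sqrt hq0.le
  choose S hS hcard using h.exists_sphere
  set r := (√(q : ℝ))⁻¹ with hr
  have hr2 : r ^ 2 = (q : ℝ)⁻¹ := by rw [hr, inv_pow, hsq]
  set g : ℕ → ℝ := fun k => if 1 ≤ k ∧ k ≤ n + 2 then r ^ k else 0 with hg
  have hdisj : ∀ t : Set ℕ, t.PairwiseDisjoint S := by
    intro t i _ j _ hij
    rw [Function.onFun, Finset.disjoint_left]
    intro v hi hj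
    rw [hS] at hi hj
    omega
  have hsphere : ∀ k, ∑ v ∈ S k, (r ^ level v) ^ 2 = ((q : ℝ) + 1) / q := by
    intro k
    rw [Finset.sum_congr rfl fun v hv => by rw [(hS k v).1 hv], Finset.sum_const, hcard,
      nsmul_eq_mul, ← pow_mul, mul_comm (k + 1), pow_mul, hr2, inv_pow]
    push_cast
    field_simp
    ring
  have hsupp : ∀ v, v ∉ (Finset.range (n + 2)).biUnion S → g (level v) = 0 := by
    intro v hv
    rw [hg]
    refine if_neg fun hl => hv ?_
    rw [Finset.mem_biUnion]
    exact ⟨level v - 1, Finset.mem_range.2 (by omega), (hS _ v).2 (by omega)⟩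
  have hmem : Memℓp (E := fun _ : V => ℂ) (fun v => ((g (level v) : ℝ) : ℂ)) 2 := by
    refine memℓp_gen (summable_of_ne_finset_zero (s := (Finset.range (n + 2)).biUnion S) ?_)
    intro v hv
    simp [hsupp v hv]
  set f : lp (fun _ : V => ℂ) 2 := ⟨_, hmem⟩
  have hfv : ∀ v, f v = ((g (level v) : ℝ) : ℂ) := fun v => rfl
  have hnorm : ‖f‖ ^ 2 = (n + 2) * (((q : ℝ) + 1) / q) := by
    have h1 := lp.norm_rpow_eq_tsum (p := 2) (by simp) f
    simp only [ENNReal.toReal_ofNat, Real.rpow_ofNat] at h1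
    rw [h1, tsum_eq_sum (s := (Finset.range (n + 2)).biUnion S),
      Finset.sum_biUnion (hdisj _)]
    · rw [Finset.sum_congr rfl (g := fun _ => ((q : ℝ) + 1) / q)]
      · simp
      · intro k hk
        rw [Finset.mem_range] at hk
        rw [← hsphere k]
        refine Finset.sum_congr rfl fun v hv => ?_
        rw [hS] at hv
        rw [hfv, hg]
        simp only [hv]
        rw [if_pos (by omega), Complex.norm_real, Real.norm_eq_abs, sq_abs]
    · intro v hv
      simp [hfv, hsupp v hv]
  have hMf : ∀ k < n, ∀ v ∈ S (k + 1),
      ‖(M f) v‖ ^ 2 = (2 * √(q : ℝ) / (q + 1)) ^ 2 * (r ^ level v) ^ 2 := by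
    intro k hk v hv
    rw [hS] at hv
    have h1 : ∑ w ∈ nbr v, g (level w) = 2 * √(q : ℝ) * r ^ level v := by
      rw [h.sum_level_of_eq_succ g hv, hg, hv]
      simp only []
      rw [if_pos (by omega), if_pos (by omega)]
      exact inv_sqrt_pow_add_mul_inv_sqrt_pow hq0 (k + 1)
    have h2 : (M f) v = ((1 / ((q : ℝ) + 1) * (2 * √(q : ℝ) * r ^ level v) : ℝ) : ℂ) := by
      rw [hM, ← h1]
      simp only [hfv]
      push_cast
      rfl
    rw [h2, Complex.norm_real, Real.norm_eq_abs, sq_abs]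
    ring
  have hlow : n * (2 * √(q : ℝ) / (q + 1)) ^ 2 * (((q : ℝ) + 1) / q) ≤ ‖M f‖ ^ 2 := by
    refine le_trans (le_of_eq ?_)
      (sum_norm_sq_le (M f) ((Finset.range n).biUnion fun k => S (k + 1)))
    rw [Finset.sum_biUnion]
    · rw [Finset.sum_congr rfl
        (g := fun _ => (2 * √(q : ℝ) / (q + 1)) ^ 2 * (((q : ℝ) + 1) / q))]
      · simp [mul_assoc]
      · intro k hk
        rw [Finset.sum_congr rfl (hMf k (Finset.mem_range.1 hk)), ← Finset.mul_sum, hsphere]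
    · intro i hi j hj hij
      exact hdisj Set.univ (Set.mem_univ _) (Set.mem_univ _) (by simpa using hij)
  have hup : ‖M f‖ ^ 2 ≤ ‖M‖ ^ 2 * ‖f‖ ^ 2 := by
    rw [← mul_pow]
    gcongr
    exact M.le_opNorm f
  rw [hnorm, ← mul_assoc] at hup
  exact le_of_mul_le_mul_right (hlow.trans hup) (by positivity)

/-- The simple random walk operator of a `(q + 1)`-regular tree has norm `2√q/(q + 1)`. -/
theorem norm_eq (h : IsLeveledRegularTree nbr level q o) (hq : 1 ≤ q)
    (hM : ∀ (f : lp (fun _ : V => ℂ) 2) (v : V),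
      (M f) v = (1 / ((q : ℂ) + 1)) * ∑ w ∈ nbr v, f w) :
    ‖M‖ = 2 * √(q : ℝ) / (q + 1) := by
  refine le_antisymm (h.norm_le hq hM) ?_
  have hlow := h.mul_le_norm_sq_mul hq hM
  set C := 2 * √(q : ℝ) / (q + 1)
  refine le_of_sq_le_sq ?_ (norm_nonneg M)
  by_contra! hlt
  obtain ⟨n, hn⟩ := exists_nat_gt (2 * ‖M‖ ^ 2 / (C ^ 2 - ‖M‖ ^ 2))
  rw [div_lt_iff₀ (by linarith)] at hn
  linarith [hlow n]

end IsLeveledRegularTree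

/-- A regular tree, leveled by the distance to a vertex. -/
lemma SimpleGraph.IsTree.isLeveledRegularTree {V : Type*} {T : SimpleGraph V}
    [∀ v : V, Fintype (T.neighborSet v)] (hT : T.IsTree) {q : ℕ}
    (hreg : ∀ v : V, T.degree v = q + 1) (o : V) :
    IsLeveledRegularTree (fun v => T.neighborFinset v) (T.dist o) q o where
  symm v w hw := by
    rw [SimpleGraph.mem_neighborFinset] at hw ⊢
    exact hw.symm
  card_nbr v := by rw [SimpleGraph.card_neighborFinset_eq_degree, hreg]
  level_eq_zero v := by rw [hT.connected.dist_eq_zero_iff, eq_comm]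
  level_step v w hw := by
    rw [SimpleGraph.mem_neighborFinset] at hw
    exact (hT.dist_eq_dist_add_one_of_adj o hw).symm
  parent v hv := by
    simp only [SimpleGraph.mem_neighborFinset]
    have key : ∀ w, T.Adj v w → T.dist o v = T.dist o w + 1 →
        ∃ p : T.Walk o v, p.IsPath ∧ p.penultimate = w := by
      intro w hw hd
      obtain ⟨p, hp⟩ := hT.connected.exists_walk_length_eq_dist o w
      refine ⟨p.concat hw.symm, ?_, by simp⟩
      apply SimpleGraph.Walk.isPath_of_length_eq_dist
      rw [SimpleGraph.Walk.length_concat, hp, hd]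
    obtain ⟨p, hp⟩ := hT.connected.exists_walk_length_eq_dist o v
    have hnil : ¬ p.Nil := by
      rw [← SimpleGraph.Walk.length_eq_zero_iff]
      omega
    have hadj := (p.adj_penultimate hnil).symm
    have hlen : p.dropLast.length + 1 = p.length := p.length_dropLast_add_one hnil
    refine ⟨p.penultimate, ⟨hadj, ?_⟩, ?_⟩
    · have h1 := SimpleGraph.dist_le p.dropLast
      rcases hT.dist_eq_dist_add_one_of_adj o hadj with h2 | h2 <;> omega
    · rintro w ⟨hw, hd⟩
      obtain ⟨p', hp', rfl⟩ := key w hw hd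
      rw [(hT.existsUnique_path o v).unique hp' (p.isPath_of_length_eq_dist hp)]

namespace FreeGroup

lemma inv_mk_singleton {α : Type*} (p : α × Bool) : (mk [p])⁻¹ = mk [(p.1, !p.2)] := by
  simp [inv_mk, invRev]

variable {α : Type*} [DecidableEq α]

lemma toWord_mk_singleton_mul (p : α × Bool) (x : FreeGroup α) :
    (∃ L, x.toWord = (p.1, !p.2) :: L ∧ (mk [p] * x).toWord = L) ∨
      (mk [p] * x).toWord = p :: x.toWord := by
  have h : (mk [p] * x).toWord = reduce (p :: x.toWord) := by
    rw [toWord_mul, toWord_mk, reduce_singleton, List.singleton_append]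
  rw [h, reduce.cons, reduce_toWord]
  rcases x.toWord with _ | ⟨a, L⟩
  · right
    rfl
  · by_cases ha : p.1 = a.1 ∧ p.2 = !a.2
    · left
      exact ⟨L, by simp [ha.1, ha.2], by simp [ha]⟩
    · right
      simp [ha]

/-- The Cayley graph of a free group, leveled by word length. -/
lemma isLeveledRegularTree [Fintype α] {q : ℕ} (hq : 2 * Fintype.card α = q + 1) :
    IsLeveledRegularTree
      (fun x : FreeGroup α => Finset.univ.image fun p : α × Bool => mk [p] * x) norm q 1 where
  symm v w hw := by
    simp only [Finset.mem_image, Finset.mem_univ, true_and] at hw ⊢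
    obtain ⟨p, rfl⟩ := hw
    exact ⟨(p.1, !p.2), by rw [← inv_mk_singleton, inv_mul_cancel_left]⟩
  card_nbr v := by
    rw [Finset.card_image_of_injective, Finset.card_univ, Fintype.card_prod, Fintype.card_bool,
      mul_comm, hq]
    intro p p' h
    have := congrArg toWord (mul_right_cancel h)
    simpa [reduce_singleton] using this
  level_eq_zero v := norm_eq_zero
  level_step v w hw := by
    simp only [Finset.mem_image, Finset.mem_univ, true_and] at hw
    obtain ⟨p, rfl⟩ := hw
    rcases toWord_mk_singleton_mul p v with ⟨L, h1, h2⟩ | h1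
    · right
      simp [norm, h1, h2]
    · left
      simp [norm, h1]
  parent v hv := by
    simp only [Finset.mem_image, Finset.mem_univ, true_and]
    obtain ⟨a, L, hL⟩ := List.exists_cons_of_ne_nil
      (show v.toWord ≠ [] from fun h => hv (by simp [norm, h]))
    have key : ∀ w : FreeGroup α, w = mk L ↔
        (∃ p : α × Bool, mk [p] * v = w) ∧ v.norm = w.norm + 1 := by
      intro w
      constructor
      · rintro rfl
        have hmul : mk [(a.1, !a.2)] * v = mk L := by
          rw [← inv_mk_singleton, inv_mul_eq_iff_eq_mul, mul_mk, List.singleton_append, ← hL,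
            mk_toWord]
        refine ⟨⟨_, hmul⟩, ?_⟩
        rcases toWord_mk_singleton_mul (a.1, !a.2) v with ⟨L', h1, h2⟩ | h1
        · rw [← hmul]
          simp [norm, h1, h2]
        · rw [hmul] at h1
          have h2 := norm_mk_le (L₁ := L)
          rw [norm, h1, hL] at h2
          simp at h2
      · rintro ⟨⟨p, rfl⟩, hn⟩
        rcases toWord_mk_singleton_mul p v with ⟨L', h1, h2⟩ | h1
        · rw [hL, List.cons.injEq] at h1
          rw [h1.2, ← h2, mk_toWord]
        · simp [norm, h1] at hn
          omega
    exact ⟨mk L, (key _).1 rfl, fun w hw => (key w).2 hw⟩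

end FreeGroup

/-- **Kesten.** For `d ≥ 2`, the Markov operator `M` of the simple random walk on the
`d`-regular tree `T`, acting on `ℓ²(T)` by `Mf(v) = (1/d) ∑_{w ∼ v} f(w)`, has operator norm
`2√(d-1)/d`.  In particular, for the free group `F_N` on `N` generators and `μ` the uniform
distribution on the `2N` generators and their inverses, the convolution operator
`π_{F_N}(μ)` on `ℓ²(F_N)` (given by left translations) has norm `√(2N-1)/N`. -/
theorem norm_markov_operator_regular_tree
    {V : Type*} (d : ℕ) (hd : 2 ≤ d)
    (T : SimpleGraph V) [∀ v : V, Fintype (T.neighborSet v)]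
    (hT : T.IsTree) (hreg : ∀ v : V, T.degree v = d)
    (M : lp (fun _ : V => ℂ) 2 →L[ℂ] lp (fun _ : V => ℂ) 2)
    (hM : ∀ (f : lp (fun _ : V => ℂ) 2) (v : V),
      (M f) v = (1 / (d : ℂ)) * ∑ w ∈ T.neighborFinset v, f w) :
    ‖M‖ = 2 * Real.sqrt ((d : ℝ) - 1) / (d : ℝ) ∧
    ∀ (N : ℕ), 1 ≤ N →
      ∀ (M' : lp (fun _ : FreeGroup (Fin N) => ℂ) 2 →L[ℂ]
            lp (fun _ : FreeGroup (Fin N) => ℂ) 2),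
        (∀ (f : lp (fun _ : FreeGroup (Fin N) => ℂ) 2) (x : FreeGroup (Fin N)),
          (M' f) x = (1 / (2 * N : ℂ)) *
            ∑ i : Fin N, (f ((FreeGroup.of i)⁻¹ * x) + f (FreeGroup.of i * x))) →
        ‖M'‖ = Real.sqrt (2 * (N : ℝ) - 1) / (N : ℝ) := by
  constructor
  · obtain ⟨q, rfl⟩ : ∃ q, d = q + 1 := ⟨d - 1, by omega⟩
    obtain ⟨o⟩ := hT.connected.nonempty
    rw [(hT.isLeveledRegularTree hreg o).norm_eq (by omega) fun f v => by
      rw [hM]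
      push_cast
      rfl]
    push_cast
    rw [add_sub_cancel_right]
  · intro N hN M' hM'
    obtain ⟨q, hq⟩ : ∃ q, 2 * N = q + 1 := ⟨2 * N - 1, by omega⟩
    have hqR : (2 * N : ℝ) = q + 1 := by exact_mod_cast hq
    have hqC : (2 * N : ℂ) = q + 1 := by exact_mod_cast hq
    rw [(FreeGroup.isLeveledRegularTree (α := Fin N) (by simpa using hq)).norm_eq (by omega)
      fun f x => ?_, ← hqR, show (q : ℝ) = 2 * N - 1 by linarith]
    · rw [mul_div_mul_left _ _ two_ne_zero]
    · rw [hM', hqC, Finset.sum_image, Fintype.sum_prod_type]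
      · congr 1
        refine Finset.sum_congr rfl fun i _ => ?_
        rw [Fintype.sum_bool, add_comm]
        rfl
      · intro p _ p' _ h
        have := congrArg FreeGroup.toWord (mul_right_cancel h)
        simpa [FreeGroup.reduce_singleton] using this
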